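/- Let f : ℝⁿ → ℝ be convex and differentiable at a point x̂, and suppose f is pointwise quadratically supportable at x̂ (hence, by convexity, pointwise quadratically supportable at x̂ on bounded sets). Let (xᵏ)_{k∈ℕ} be any bounded sequence in ℝⁿ. Then there exists μ > 0 such that f(xᵏ) ≥ f(x̂) + ⟨∇f(x̂), xᵏ − x̂⟩ + (μ/2)‖xᵏ − x̂‖² for all k. -/

import Mathlib

open scoped RealInnerProductSpace

/-- If `f : ℝⁿ → ℝ` is convex, differentiable at `x̂` (with gradient `g`), and pointwise
quadratically supportable at `x̂`, then for any bounded sequence `(xᵏ)` there exists `μ > 0`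
such that `f(xᵏ) ≥ f(x̂) + ⟪∇f(x̂), xᵏ - x̂⟫ + (μ/2) ‖xᵏ - x̂‖²` for all `k`. -/
theorem pqs_along_bounded_sequence {n : ℕ}
    (f : EuclideanSpace ℝ (Fin n) → ℝ) (xhat g : EuclideanSpace ℝ (Fin n))
    (hconv : ConvexOn ℝ Set.univ f)
    (hdiff : HasGradientAt f g xhat)
    (hpqs : ∃ V ∈ nhds xhat, ∃ μ : ℝ, 0 < μ ∧
      ∀ x ∈ V, f xhat + ⟪g, x - xhat⟫ + μ / 2 * ‖x - xhat‖ ^ 2 ≤ f x)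
    (x : ℕ → EuclideanSpace ℝ (Fin n))
    (hbdd : Bornology.IsBounded (Set.range x)) :
    ∃ μ : ℝ, 0 < μ ∧
      ∀ k : ℕ, f xhat + ⟪g, x k - xhat⟫ + μ / 2 * ‖x k - xhat‖ ^ 2 ≤ f (x k) := by
  obtain ⟨V, hV, μ, hμ, h⟩ := hpqs
  obtain ⟨r, hr, hball⟩ := Metric.mem_nhds_iff.1 hV
  obtain ⟨R, hR, hsub⟩ := hbdd.subset_ball_lt 0 xhat
  have ht0 : 0 < r / (R + r) := by positivity
  have ht1 : r / (R + r) ≤ 1 := by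
    rw [div_le_one (by positivity)]; linarith
  have htR : r / (R + r) * R < r := by
    rw [div_mul_eq_mul_div, div_lt_iff₀ (by positivity)]; nlinarith
  generalize r / (R + r) = t at ht0 ht1 htR
  refine ⟨μ * t, by positivity, fun k => ?_⟩
  have hk : ‖x k - xhat‖ < R := by
    have := hsub (Set.mem_range_self k)
    rwa [Metric.mem_ball, dist_eq_norm] at this
  have hy : xhat + t • (x k - xhat) ∈ V := by
    apply hball
    rw [Metric.mem_ball, dist_eq_norm, add_sub_cancel_left, norm_smul, Real.norm_of_nonneg ht0.le]
    nlinarith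
  have h1 := h _ hy
  rw [add_sub_cancel_left, norm_smul, Real.norm_of_nonneg ht0.le, inner_smul_right] at h1
  have h2 := hconv.2 (Set.mem_univ xhat) (Set.mem_univ (x k)) (sub_nonneg.2 ht1) ht0.le (by ring)
  have he : (1 - t) • xhat + t • x k = xhat + t • (x k - xhat) := by module
  rw [he, smul_eq_mul, smul_eq_mul] at h2
  refine le_of_mul_le_mul_left ?_ ht0
  nlinarith
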